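/- Let k be an algebraically closed field of characteristic zero and r ≥ 3 an integer. Let T ⊂ ℙ^r(k) be a set of r+3 points in linearly general position. Then there exists exactly one rational normal curve D ⊂ ℙ^r(k) with T ⊂ D. -/

import Mathlib

open Projectivization

/-- The standard rational normal curve in `ℙ^r(k)`: the set of points represented by
vectors `(a^r, a^(r-1)b, …, b^r)` for `(a,b) ∈ k² \ {0}` (equivalently, for `a, b` such
that this vector is nonzero). -/
def stdRNC (k : Type*) [Field k] (r : ℕ) :
    Set (Projectivization k (Fin (r + 1) → k)) :=
  {P | ∃ (a b : k)
      (h : (fun j : Fin (r + 1) => a ^ (r - (j : ℕ)) * b ^ (j : ℕ)) ≠ 0),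
      P = Projectivization.mk k _ h}

/-- A rational normal curve in `ℙ^r(k)` is the image of the standard rational normal
curve under the projectivization of an invertible linear map of `k^(r+1)`. -/
def IsRNC (k : Type*) [Field k] (r : ℕ)
    (D : Set (Projectivization k (Fin (r + 1) → k))) : Prop :=
  ∃ g : (Fin (r + 1) → k) ≃ₗ[k] (Fin (r + 1) → k),
    D = Projectivization.map (g : (Fin (r + 1) → k) →ₗ[k] (Fin (r + 1) → k))
      g.injective '' stdRNC k r

/-- A set of points of `ℙ^r(k)` is in linearly general position if any at most `r+1`
of them have linearly independent representative vectors in `k^(r+1)`. -/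
def InLinGenPos (k : Type*) [Field k] (r : ℕ)
    (S : Set (Projectivization k (Fin (r + 1) → k))) : Prop :=
  ∀ T : Finset (Projectivization k (Fin (r + 1) → k)), ↑T ⊆ S → T.card ≤ r + 1 →
    LinearIndependent k (fun P : T => Projectivization.rep P.1)

/-- The Veronese vector. -/
def nuVec {k : Type*} [Field k] (r : ℕ) (a b : k) : Fin (r + 1) → k :=
  fun j => a ^ (r - (j : ℕ)) * b ^ (j : ℕ)

theorem prod_forms {k : Type*} [Field k] {ι : Type*} (S : Finset ι) (p q : ι → k) :
    ∃ c : ℕ → k, ∀ a b : k, ∏ i ∈ S, (p i * a + q i * b) =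
      ∑ j ∈ Finset.range (S.card + 1), c j * (a ^ (S.card - j) * b ^ j) := by
  classical
  induction S using Finset.induction_on with
  | empty => exact ⟨fun _ => 1, fun a b => by simp⟩
  | insert x S hx ih =>
    obtain ⟨c, hc⟩ := ih
    refine ⟨fun j => (if j ≤ S.card then p x * c j else 0) +
      (if j = 0 then 0 else q x * c (j - 1)), fun a b => ?_⟩
    rw [Finset.prod_insert hx, hc, Finset.card_insert_of_notMem hx]
    simp only [add_mul, Finset.sum_add_distrib]
    congr 1
    · rw [Finset.sum_range_succ _ (S.card + 1)]
      simp only [Finset.mul_sum]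
      rw [if_neg (by omega), zero_mul, add_zero]
      refine Finset.sum_congr rfl fun j hj => ?_
      have hj' : j ≤ S.card := by simpa [Nat.lt_succ_iff] using hj
      rw [if_pos hj', show S.card + 1 - j = (S.card - j) + 1 by omega, pow_succ]
      ring
    · rw [Finset.sum_range_succ' _ (S.card + 1)]
      simp only [Finset.mul_sum]
      simp only [if_true, zero_mul, add_zero]
      refine Finset.sum_congr rfl fun j hj => ?_
      rw [if_neg (by omega), show S.card + 1 - (j + 1) = S.card - j by omega, pow_succ]
      simp only [Nat.add_sub_cancel]
      ring

theorem exists_lin {k : Type*} [Field k] (r : ℕ) (p q : Fin (r + 1) → k) :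
    ∃ h : (Fin (r + 1) → k) →ₗ[k] (Fin (r + 1) → k), ∀ a b : k,
      h (nuVec r a b) = fun j => ∏ i ∈ Finset.univ.erase j, (p i * a + q i * b) := by
  choose c hc using fun j : Fin (r + 1) => prod_forms (Finset.univ.erase j) p q
  refine ⟨Matrix.toLin' (Matrix.of fun j m : Fin (r + 1) => c j m), fun a b => ?_⟩
  ext j
  rw [hc]
  have hcard : (Finset.univ.erase j).card = r := by simp
  rw [hcard, Finset.sum_range, Matrix.toLin'_apply]
  rfl

/-- The explicit curve. -/
def curveVec {k : Type*} [Field k] (r : ℕ) (d : Fin (r + 1) → k) (a b : k) : Fin (r + 1) → k :=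
  fun j => ∏ i ∈ Finset.univ.erase j, (a + d i * b)

theorem exists_equiv {k : Type*} [Field k] (r : ℕ) (d : Fin (r + 1) → k)
    (hd : Function.Injective d) :
    ∃ g : (Fin (r + 1) → k) ≃ₗ[k] (Fin (r + 1) → k), ∀ a b : k,
      g (nuVec r a b) = curveVec r d a b := by
  obtain ⟨h, hh⟩ := exists_lin r (fun _ => 1) d
  have hh' : ∀ a b, h (nuVec r a b) = curveVec r d a b := by
    intro a b; rw [hh]; ext j; simp [curveVec]
  have hsurj : Function.Surjective h := by
    rw [← LinearMap.range_eq_top, eq_top_iff, ← (Pi.basisFun k (Fin (r + 1))).span_eq,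
      Submodule.span_le]
    rintro _ ⟨j, rfl⟩
    have hne : ∏ i ∈ Finset.univ.erase j, (-d j + d i * 1) ≠ 0 := by
      rw [Finset.prod_ne_zero_iff]
      intro i hi h0
      have : d i = d j := by linear_combination h0
      exact (Finset.mem_erase.1 hi).1 (hd this)
    refine ⟨(∏ i ∈ Finset.univ.erase j, (-d j + d i * 1))⁻¹ • nuVec r (-d j) 1, ?_⟩
    rw [map_smul, hh']
    ext l
    simp only [Pi.smul_apply, smul_eq_mul, Pi.basisFun_apply, curveVec]
    by_cases hl : l = j
    · subst hl; rw [inv_mul_cancel₀ hne]; simp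
    · rw [Finset.prod_eq_zero (i := j) (Finset.mem_erase.2 ⟨Ne.symm hl, Finset.mem_univ _⟩)
        (by ring)]
      simp [hl]
  exact ⟨LinearEquiv.ofBijective h ⟨LinearMap.injective_iff_surjective.2 hsurj, hsurj⟩, hh'⟩

theorem erase_prod {k : Type*} [Field k] {r : ℕ} (L : Fin (r + 1) → k) (j : Fin (r + 1)) :
    L j * ∏ i ∈ Finset.univ.erase j, L i = ∏ i, L i :=
  Finset.mul_prod_erase _ _ (Finset.mem_univ j)

theorem uniq_vec {k : Type*} [Field k] (r : ℕ) (hr : 3 ≤ r) (c : Fin (r + 1) → k)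
    (hc0 : ∀ i, c i ≠ 0) (hc : Function.Injective c)
    (g : (Fin (r + 1) → k) ≃ₗ[k] (Fin (r + 1) → k))
    (s t μ : Fin (r + 1) → k) (hμ : ∀ i, μ i ≠ 0)
    (hst : ∀ i, g (nuVec r (s i) (t i)) = μ i • Pi.single i 1)
    (u v ρ : k) (hρ : ρ ≠ 0) (huv : g (nuVec r u v) = fun _ => ρ)
    (u' v' σ : k) (hσ : σ ≠ 0) (huv' : g (nuVec r u' v') = σ • c) :
    (∀ a b, ∃ α β τ : k, τ ≠ 0 ∧ g (nuVec r a b) = τ • curveVec r (fun i => (c i)⁻¹) α β) ∧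
    (∀ α β, ∃ a b τ : k, τ ≠ 0 ∧ g (nuVec r a b) = τ • curveVec r (fun i => (c i)⁻¹) α β) := by
  obtain ⟨h, hh⟩ := exists_lin r t (fun i => - s i)
  -- basis
  have hli : LinearIndependent k (fun i => nuVec r (s i) (t i)) := by
    have h1 : LinearIndependent k (fun i : Fin (r + 1) => μ i • (Pi.single i 1 : Fin (r + 1) → k)) := by
      have := (Pi.basisFun k (Fin (r + 1))).linearIndependent.units_smul
        (fun i => Units.mk0 (μ i) (hμ i))
      convert this using 2 with i
      simp [Units.smul_def]
    have h2 : LinearIndependent k (g.toLinearMap ∘ (fun i => nuVec r (s i) (t i))) := by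
      convert h1 using 2 with i
      exact hst i
    exact h2.of_comp _
  let B := basisOfLinearIndependentOfCardEqFinrank hli (by simp)
  have hB : ∀ i, B i = nuVec r (s i) (t i) := fun i => by
    simp [B]
  -- distinctness
  have hdist : ∀ i j, i ≠ j → t j * s i + - s j * t i ≠ 0 := by
    intro i j hij h0
    have hne : ∀ i, nuVec r (s i) (t i) ≠ 0 := fun i => hli.ne_zero i
    have hst0 : ∀ i, s i ≠ 0 ∨ t i ≠ 0 := by
      intro i
      by_contra hcon
      push Not at hcon
      apply hne i
      ext m
      simp only [nuVec, hcon.1, hcon.2, Pi.zero_apply, ← pow_add]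
      exact zero_pow (by omega)
    obtain ⟨w, h1, h2⟩ : ∃ w, s i = w * s j ∧ t i = w * t j := by
      rcases hst0 j with hj | hj
      · exact ⟨s i / s j, by field_simp, by field_simp; linear_combination - h0⟩
      · exact ⟨t i / t j, by field_simp; linear_combination h0, by field_simp⟩
    have h3 : nuVec r (s i) (t i) = w ^ r • nuVec r (s j) (t j) := by
      ext m
      have : w ^ r = w ^ (r - (m : ℕ)) * w ^ (m : ℕ) := by
        rw [← pow_add]; congr 1; omega
      simp only [nuVec, h1, h2, Pi.smul_apply, smul_eq_mul, mul_pow, this]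
      ring
    have hg := congrArg g h3
    rw [map_smul, hst, hst] at hg
    have := congrFun hg i
    simp [hij] at this
    exact hμ i this
  let κ : Fin (r + 1) → k := fun i => ∏ l ∈ Finset.univ.erase i, (t l * s i + - s l * t i)
  have hκ : ∀ i, κ i ≠ 0 := by
    intro i
    refine Finset.prod_ne_zero_iff.2 fun l hl => hdist i l ?_
    exact (Finset.mem_erase.1 hl).1.symm
  let lam : Fin (r + 1) → k := fun i => μ i / κ i
  have hlam : ∀ i, lam i ≠ 0 := fun i => div_ne_zero (hμ i) (hκ i)
  have hgeq : g.toLinearMap = (LinearMap.pi fun j => lam j • LinearMap.proj j) ∘ₗ h := by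
    refine B.ext fun i => ?_
    rw [hB]
    ext j
    simp only [LinearEquiv.coe_coe, LinearMap.comp_apply, LinearMap.pi_apply, hst, hh,
      LinearMap.smul_apply, LinearMap.proj_apply, Pi.smul_apply, smul_eq_mul]
    by_cases hij : j = i
    · subst hij
      have : lam j * κ j = μ j := div_mul_cancel₀ _ (hκ j)
      simpa [κ] using this.symm
    · rw [Finset.prod_eq_zero (i := i) (Finset.mem_erase.2 ⟨Ne.symm hij, Finset.mem_univ _⟩)
        (by ring)]
      simp [hij]
  have hg : ∀ a b j, g (nuVec r a b) j =
      lam j * ∏ i ∈ Finset.univ.erase j, (t i * a + - s i * b) := by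
    intro a b j
    have := congrFun (LinearMap.congr_fun hgeq (nuVec r a b)) j
    simpa [hh] using this
  let L : Fin (r + 1) → k := fun i => t i * u + - s i * v
  let M : Fin (r + 1) → k := fun i => t i * u' + - s i * v'
  have hL1 : ∀ j, lam j * ∏ i ∈ Finset.univ.erase j, L i = ρ := fun j => by
    rw [← hg, huv]
  have hM1 : ∀ j, lam j * ∏ i ∈ Finset.univ.erase j, M i = σ * c j := fun j => by
    rw [← hg, huv']; rfl
  have key : ∀ N : Fin (r + 1) → k, (∀ j, ∏ i ∈ Finset.univ.erase j, N i ≠ 0) → ∀ i, N i ≠ 0 := by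
    intro N hN i
    obtain ⟨j, hj⟩ : ∃ j : Fin (r + 1), j ≠ i := by
      have : Nontrivial (Fin (r + 1)) := Fin.nontrivial_iff_two_le.2 (by omega)
      exact exists_ne i
    exact Finset.prod_ne_zero_iff.1 (hN j) i (Finset.mem_erase.2 ⟨hj.symm, Finset.mem_univ _⟩)
  have hL0 : ∀ i, L i ≠ 0 := key L fun j h0 => hρ (by rw [← hL1 j, h0, mul_zero])
  have hM0 : ∀ i, M i ≠ 0 := key M fun j h0 =>
    mul_ne_zero hσ (hc0 j) (by rw [← hM1 j, h0, mul_zero])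
  have hPL : ∏ i, L i ≠ 0 := Finset.prod_ne_zero_iff.2 fun i _ => hL0 i
  have hPM : ∏ i, M i ≠ 0 := Finset.prod_ne_zero_iff.2 fun i _ => hM0 i
  have hL2 : ∀ j, lam j * ∏ i, L i = ρ * L j := fun j => by
    rw [← erase_prod L j, ← hL1 j]; ring
  have hM2 : ∀ j, lam j * ∏ i, M i = σ * c j * M j := fun j => by
    rw [← erase_prod M j, ← hM1 j]; ring
  obtain ⟨θ, hθ0, hθ⟩ : ∃ θ : k, θ ≠ 0 ∧ ∀ j, M j = θ * (L j * (c j)⁻¹) := by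
    refine ⟨(∏ i, M i) * ρ / ((∏ i, L i) * σ), ?_, fun j => ?_⟩
    · exact div_ne_zero (mul_ne_zero hPM hρ) (mul_ne_zero hPL hσ)
    · have h1 := hL2 j
      have h2 := hM2 j
      have h3 := hc0 j
      field_simp
      linear_combination (∏ i, M i) * h1 - (∏ i, L i) * h2
  have main : ∀ α β, g (nuVec r (α * u + β * u') (α * v + β * v')) =
      ρ • curveVec r (fun i => (c i)⁻¹) α (β * θ) := by
    intro α β
    ext j
    rw [hg, Pi.smul_apply, smul_eq_mul, ← hL1 j, curveVec, mul_assoc, ← Finset.prod_mul_distrib]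
    congr 1
    refine Finset.prod_congr rfl fun i _ => ?_
    have := hθ i
    simp only [L, M] at this ⊢
    linear_combination β * this
  constructor
  · have hΔ : u * v' - v * u' ≠ 0 := by
      intro h0
      have hLM : ∀ i j, L i * M j = L j * M i := by
        intro i j
        simp only [L, M]
        linear_combination (s i * t j - t i * s j) * h0
      have hij : (⟨0, by omega⟩ : Fin (r + 1)) ≠ ⟨1, by omega⟩ := by simp
      apply hij
      apply hc
      have h1 := hLM ⟨0, by omega⟩ ⟨1, by omega⟩
      rw [hθ, hθ] at h1
      have h2 := hL0 ⟨0, by omega⟩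
      have h3 := hL0 ⟨1, by omega⟩
      have h4 := hc0 ⟨0, by omega⟩
      have h5 := hc0 ⟨1, by omega⟩
      have h6 : θ * L ⟨0, by omega⟩ * L ⟨1, by omega⟩ *
        ((c ⟨1, by omega⟩)⁻¹ - (c ⟨0, by omega⟩)⁻¹) = 0 := by linear_combination h1
      have h7 := (mul_eq_zero.1 h6).resolve_left (mul_ne_zero (mul_ne_zero hθ0 h2) h3)
      exact (inv_injective (sub_eq_zero.1 h7)).symm
    intro a b
    refine ⟨(a * v' - b * u') / (u * v' - v * u'),
      ((b * u - a * v) / (u * v' - v * u')) * θ, ρ, hρ, ?_⟩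
    rw [← main]
    congr 2
    · have hinv := mul_inv_cancel₀ hΔ
      simp only [div_eq_mul_inv]
      linear_combination (-a) * hinv
    · have hinv := mul_inv_cancel₀ hΔ
      simp only [div_eq_mul_inv]
      linear_combination (-b) * hinv
  · intro α β
    refine ⟨_, _, ρ, hρ, (main α (β / θ)).trans ?_⟩
    rw [div_mul_cancel₀ _ hθ0]

theorem mem_rnc {k : Type*} [Field k] (r : ℕ)
    (g : (Fin (r + 1) → k) ≃ₗ[k] (Fin (r + 1) → k))
    (P : Projectivization k (Fin (r + 1) → k)) :
    P ∈ Projectivization.map (g : (Fin (r + 1) → k) →ₗ[k] (Fin (r + 1) → k))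
      g.injective '' stdRNC k r ↔ ∃ a b τ : k, τ ≠ 0 ∧ g (nuVec r a b) = τ • P.rep := by
  constructor
  · rintro ⟨_, ⟨a, b, h, rfl⟩, rfl⟩
    rw [Projectivization.map_mk]
    have hn : g (nuVec r a b) ≠ 0 := by
      rw [Ne, LinearEquiv.map_eq_zero_iff]; exact h
    obtain ⟨x, hx⟩ := Projectivization.exists_smul_eq_mk_rep k (g (nuVec r a b)) hn
    refine ⟨a, b, (x⁻¹ : kˣ), Units.ne_zero _, ?_⟩
    have : (x⁻¹ : kˣ) • (Projectivization.mk k (g (nuVec r a b)) hn).rep = g (nuVec r a b) := by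
      rw [← hx, inv_smul_smul]
    exact this.symm
  · rintro ⟨a, b, τ, hτ, h⟩
    have hn : nuVec r a b ≠ 0 := by
      intro h0
      rw [h0, map_zero] at h
      exact smul_ne_zero hτ P.rep_nonzero h.symm
    refine ⟨Projectivization.mk k (nuVec r a b) hn, ⟨a, b, hn, rfl⟩, ?_⟩
    rw [Projectivization.map_mk]
    conv_rhs => rw [← P.mk_rep]
    rw [Projectivization.mk_eq_mk_iff']
    exact ⟨τ, h.symm⟩

theorem functional_zero {k : Type*} [Field k] (r : ℕ) (w : Fin (r + 1) → (Fin (r + 1) → k))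
    (hw : LinearIndependent k w) (F : (Fin (r + 1) → k) →ₗ[k] k) (hF : ∀ l, F (w l) = 0) :
    F = 0 := by
  refine (basisOfLinearIndependentOfCardEqFinrank hw (by simp)).ext fun i => ?_
  simpa using hF i

theorem normal_form {k : Type*} [Field k] (r : ℕ)
    (w : Option (Option (Fin (r + 1))) → (Fin (r + 1) → k))
    (hw : ∀ f : Fin (r + 1) → Option (Option (Fin (r + 1))), Function.Injective f →
      LinearIndependent k (w ∘ f)) :
    ∃ (φ : (Fin (r + 1) → k) ≃ₗ[k] (Fin (r + 1) → k)) (c μ : Fin (r + 1) → k),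
      (∀ i, c i ≠ 0) ∧ Function.Injective c ∧ (∀ i, μ i ≠ 0) ∧
      (∀ i, φ (w (some (some i))) = μ i • Pi.single i 1) ∧
      (φ (w (some none)) = fun _ => 1) ∧ φ (w none) = c := by
  have h0 := hw (fun i => some (some i)) (fun i j h => by simpa using h)
  let B := basisOfLinearIndependentOfCardEqFinrank h0 (by simp)
  have hB : ∀ i, B i = w (some (some i)) := fun i => by simp [B]
  have hBB : ∀ i j, B.coord i (w (some (some j))) = if j = i then 1 else 0 := by
    intro i j
    rw [← hB, Module.Basis.coord_apply, Module.Basis.repr_self, Finsupp.single_apply]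
  have one : ∀ o : Option (Option (Fin (r + 1))), (∀ i, o ≠ some (some i)) →
      ∀ i, B.coord i (w o) ≠ 0 := by
    intro o ho i hi
    have hinj : Function.Injective (fun l : Fin (r + 1) => if l = i then o else some (some l)) := by
      intro l m hlm
      dsimp only at hlm
      split_ifs at hlm with h1 h2 h2
      · rw [h1, h2]
      · exact absurd hlm (ho _)
      · exact absurd hlm.symm (ho _)
      · simpa using hlm
    have := functional_zero r _ (hw _ hinj) (B.coord i) (by
      intro l
      simp only [Function.comp_apply]
      split_ifs with h1
      · exact hi
      · rw [hBB, if_neg h1])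
    have h1 := hBB i i
    rw [this] at h1
    simp at h1
  have hx := one (some none) (by simp)
  have hy := one none (by simp)
  have two : ∀ i j, i ≠ j → B.coord i (w none) * B.coord j (w (some none)) ≠
      B.coord j (w none) * B.coord i (w (some none)) := by
    intro i j hij h
    have hinj : Function.Injective (fun l : Fin (r + 1) =>
        if l = i then none else if l = j then some none else some (some l)) := by
      intro l m hlm
      dsimp only at hlm
      split_ifs at hlm <;> simp_all
    have := functional_zero r _ (hw _ hinj)
      (B.coord j (w (some none)) • B.coord i - B.coord i (w (some none)) • B.coord j) (by
      intro l
      simp only [Function.comp_apply, LinearMap.sub_apply, LinearMap.smul_apply, smul_eq_mul]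
      split_ifs with h1 h2
      · linear_combination h
      · ring
      · rw [hBB, hBB, if_neg h1, if_neg h2]; ring)
    have h1 := LinearMap.congr_fun this (w (some (some i)))
    simp only [LinearMap.sub_apply, LinearMap.smul_apply, smul_eq_mul, hBB, if_true, if_neg hij,
      LinearMap.zero_apply, mul_one, mul_zero, sub_zero] at h1
    exact hx j h1
  let φ : (Fin (r + 1) → k) ≃ₗ[k] (Fin (r + 1) → k) :=
    B.equivFun.trans (LinearEquiv.piCongrRight fun i =>
      LinearEquiv.smulOfNeZero k k (B.coord i (w (some none)))⁻¹ (inv_ne_zero (hx i)))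
  have hφ : ∀ z i, φ z i = (B.coord i (w (some none)))⁻¹ * B.coord i z := by
    intro z i
    rfl
  refine ⟨φ, fun i => (B.coord i (w (some none)))⁻¹ * B.coord i (w none),
    fun i => (B.coord i (w (some none)))⁻¹, fun i => mul_ne_zero (inv_ne_zero (hx i)) (hy i),
    ?_, fun i => inv_ne_zero (hx i), ?_, ?_, ?_⟩
  · intro i j hij
    by_contra hne
    apply two i j hne
    have h1 := hx i
    have h2 := hx j
    dsimp only at hij
    field_simp at hij
    linear_combination hij
  · intro i
    ext j
    rw [hφ, hBB]
    by_cases hij : i = j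
    · subst hij; simp
    · simp [hij, Ne.symm hij]
  · ext j
    rw [hφ, inv_mul_cancel₀ (hx j)]
  · ext j
    rw [hφ]

/-- Over an algebraically closed field of characteristic zero, through `r+3` points of
`ℙ^r(k)` in linearly general position (`r ≥ 3`) there passes exactly one rational
normal curve. -/
theorem statement_14 (k : Type*) [Field k] [IsAlgClosed k] [CharZero k]
    (r : ℕ) (hr : 3 ≤ r)
    (T : Finset (Projectivization k (Fin (r + 1) → k))) (hcard : T.card = r + 3)
    (hT : InLinGenPos k r ↑T) :
    ∃! D : Set (Projectivization k (Fin (r + 1) → k)), IsRNC k r D ∧ ↑T ⊆ D := by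
  classical
  have hc : Fintype.card (Option (Option (Fin (r + 1)))) = Fintype.card T := by
    simp [hcard]
  let e : Option (Option (Fin (r + 1))) ≃ T := Fintype.equivOfCardEq hc
  have hw : ∀ f : Fin (r + 1) → Option (Option (Fin (r + 1))), Function.Injective f →
      LinearIndependent k ((fun o => (e o).1.rep) ∘ f) := by
    intro f hf
    have hinj : Function.Injective (fun i => (e (f i)).1) := fun i j h =>
      hf (e.injective (Subtype.ext h))
    have h1 := hT (Finset.univ.image fun i => (e (f i)).1) (by
        intro P hP
        simp only [Finset.coe_image, Finset.coe_univ, Set.image_univ, Set.mem_range] at hP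
        obtain ⟨i, rfl⟩ := hP
        exact (e (f i)).2) (Finset.card_image_le.trans (by simp))
    exact h1.comp (fun i => ⟨(e (f i)).1, Finset.mem_image_of_mem _ (Finset.mem_univ i)⟩)
      (fun i j h => hinj (Subtype.mk.inj h))
  obtain ⟨φ, c, μ, hc0, hcinj, hμ, h1, h2, h3⟩ := normal_form r _ hw
  obtain ⟨g0, hg0⟩ := exists_equiv r (fun i => (c i)⁻¹) (inv_injective.comp hcinj)
  refine ⟨_, ⟨⟨g0.trans φ.symm, rfl⟩, ?_⟩, ?_⟩
  · intro P hP
    rw [mem_rnc]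
    suffices h : ∃ a b τ : k, τ ≠ 0 ∧ curveVec r (fun i => (c i)⁻¹) a b = τ • φ P.rep by
      obtain ⟨a, b, τ, hτ, h⟩ := h
      refine ⟨a, b, τ, hτ, ?_⟩
      rw [LinearEquiv.trans_apply, hg0, h, map_smul, LinearEquiv.symm_apply_apply]
    obtain ⟨o, ho⟩ := e.surjective ⟨P, hP⟩
    have hP' : P.rep = (e o).1.rep := by rw [ho]
    rw [hP']
    rcases o with _ | _ | i
    · rw [h3]
      refine ⟨0, 1, ∏ i, (c i)⁻¹, Finset.prod_ne_zero_iff.2 fun i _ => inv_ne_zero (hc0 i), ?_⟩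
      ext j
      rw [Pi.smul_apply, ← erase_prod (fun i => (c i)⁻¹) j]
      have := hc0 j
      simp only [curveVec, zero_add, mul_one, smul_eq_mul]
      field_simp
    · rw [h2]
      refine ⟨1, 0, 1, one_ne_zero, ?_⟩
      ext j
      simp [curveVec]
    · rw [h1]
      have hne : ∏ l ∈ Finset.univ.erase i, (-(c i)⁻¹ + (c l)⁻¹ * 1) ≠ 0 := by
        rw [Finset.prod_ne_zero_iff]
        intro l hl h0
        have : (c l)⁻¹ = (c i)⁻¹ := by linear_combination h0
        exact (Finset.mem_erase.1 hl).1 (hcinj (inv_injective this))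
      refine ⟨-(c i)⁻¹, 1, _ / μ i, div_ne_zero hne (hμ i), ?_⟩
      rw [smul_smul, div_mul_cancel₀ _ (hμ i)]
      ext j
      by_cases hij : j = i
      · subst hij; simp [curveVec]
      · simp only [curveVec]
        rw [Finset.prod_eq_zero (i := i) (Finset.mem_erase.2 ⟨Ne.symm hij, Finset.mem_univ _⟩)
          (by ring)]
        simp [hij]
  · rintro D ⟨⟨g, rfl⟩, hTD⟩
    have hm : ∀ o, ∃ a b τ : k, τ ≠ 0 ∧ (g.trans φ) (nuVec r a b) = τ • φ (e o).1.rep := by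
      intro o
      obtain ⟨a, b, τ, hτ, h⟩ := (mem_rnc r g _).1 (hTD (e o).2)
      exact ⟨a, b, τ, hτ, by rw [LinearEquiv.trans_apply, h, map_smul]⟩
    choose s t τ hτ hst using fun i : Fin (r + 1) => hm (some (some i))
    obtain ⟨u, v, ρ, hρ, huv⟩ := hm (some none)
    obtain ⟨u', v', σ, hσ, huv'⟩ := hm none
    obtain ⟨hA, hB⟩ := uniq_vec r hr c hc0 hcinj (g.trans φ) s t (fun i => τ i * μ i)
      (fun i => mul_ne_zero (hτ i) (hμ i)) (fun i => by rw [hst, h1, smul_smul])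
      u v ρ hρ (by rw [huv, h2]; ext; simp) u' v' σ hσ (by rw [huv', h3])
    ext P
    rw [mem_rnc, mem_rnc]
    constructor
    · rintro ⟨a, b, x, hx, h⟩
      obtain ⟨α, β, y, hy, h'⟩ := hA a b
      refine ⟨α, β, y⁻¹ * x, mul_ne_zero (inv_ne_zero hy) hx, ?_⟩
      rw [LinearEquiv.trans_apply, h, map_smul] at h'
      rw [LinearEquiv.trans_apply, hg0, LinearEquiv.symm_apply_eq, map_smul, mul_smul, h',
        inv_smul_smul₀ hy]
    · rintro ⟨α, β, x, hx, h⟩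
      obtain ⟨a, b, y, hy, h'⟩ := hB α β
      refine ⟨a, b, y * x, mul_ne_zero hy hx, ?_⟩
      rw [LinearEquiv.trans_apply, hg0, LinearEquiv.symm_apply_eq, map_smul] at h
      apply φ.injective
      rw [← LinearEquiv.trans_apply, h', h, map_smul, mul_smul]
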